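/- Let O = {A_1, …, A_p} be a formal orbit portrait with valence v ≥ 2. Then for each i (indices mod p): (a) there is exactly one complementary arc of A_i of length greater than 1/2 (the critical arc of A_i); (b) every complementary arc of A_i other than the critical arc is mapped injectively by the doubling map onto a complementary arc of A_{i+1}; (c) the image of the critical arc under the doubling map is the whole circle ℝ/ℤ; more precisely, there is a complementary arc C' of A_{i+1} such that every point of C' has exactly two preimages under doubling lying in the critical arc, while every point of (ℝ/ℤ) ∖ closure(C') has exactly one preimage under doubling lying in the critical arc. -/

import Mathlib

open MeasureTheory

instance : Fact ((0 : ℝ) < 1) := ⟨zero_lt_one⟩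

/-- The doubling map `θ ↦ 2θ (mod 1)` on the circle `ℝ/ℤ`. -/
noncomputable def dbl : AddCircle (1 : ℝ) → AddCircle (1 : ℝ) := fun θ => θ + θ

/-- The embedding `θ ↦ e^{2πiθ}` of `ℝ/ℤ` into `ℂ`. -/
noncomputable def circleEmbed : AddCircle (1 : ℝ) → ℂ := fun θ => (AddCircle.toCircle θ : ℂ)

/-- A formal orbit portrait `{A_1, …, A_p}` (indices mod `p`): nonempty finite sets of angles,
carried bijectively onto each other by the doubling map preserving cyclic order, with all
angles of the same exact period `r·p` under doubling, and with pairwise disjoint convex hulls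
of the corresponding sets of points of the unit circle in `ℂ`. -/
structure FormalOrbitPortrait (p r : ℕ) where
  hp : 0 < p
  hr : 1 ≤ r
  A : ZMod p → Set (AddCircle (1 : ℝ))
  nonempty : ∀ j, (A j).Nonempty
  finite : ∀ j, (A j).Finite
  bijOn : ∀ j, Set.BijOn dbl (A j) (A (j + 1))
  cyclicOrder : ∀ j, ∀ x ∈ A j, ∀ y ∈ A j, ∀ z ∈ A j,
    sbtw x y z → sbtw (dbl x) (dbl y) (dbl z)
  period : ∀ j, ∀ θ ∈ A j, Function.minimalPeriod dbl θ = r * p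
  hullDisjoint : ∀ i j : ZMod p, i ≠ j →
    Disjoint (convexHull ℝ (circleEmbed '' A i)) (convexHull ℝ (circleEmbed '' A j))

/-- A complementary arc of a finite set `A` of angles: a connected component of its
complement in the circle. -/
def IsComplArc (A : Set (AddCircle (1 : ℝ))) (I : Set (AddCircle (1 : ℝ))) : Prop :=
  ∃ x ∈ Aᶜ, I = connectedComponentIn Aᶜ x

lemma coe_eq_int {a b : ℝ} (h : (a : AddCircle (1 : ℝ)) = b) : ∃ n : ℤ, b = a + n := by
  have h' : ((b - a : ℝ) : AddCircle (1 : ℝ)) = 0 := by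
    rw [AddCircle.coe_sub, h, sub_self]
  obtain ⟨n, hn⟩ := (AddCircle.coe_eq_zero_iff (1 : ℝ)).1 h'
  refine ⟨n, ?_⟩
  simp at hn
  linarith

lemma coe_add_intCast (a : ℝ) (n : ℤ) : ((a + n : ℝ) : AddCircle (1 : ℝ)) = a := by
  have h : ((n : ℝ) : AddCircle (1 : ℝ)) = 0 :=
    (AddCircle.coe_eq_zero_iff (1 : ℝ)).2 ⟨n, by simp⟩
  rw [AddCircle.coe_add, h, add_zero]

lemma dbl_coe (a : ℝ) : dbl (a : AddCircle (1 : ℝ)) = ((2 * a : ℝ) : AddCircle (1 : ℝ)) := by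
  unfold dbl
  rw [← AddCircle.coe_add, two_mul]

lemma exists_lift_Ioc (y : AddCircle (1 : ℝ)) (a : ℝ) :
    ∃ z : ℝ, a < z ∧ z ≤ a + 1 ∧ (z : AddCircle (1 : ℝ)) = y := by
  induction y using QuotientAddGroup.induction_on with
  | H y =>
    have h := toIocMod_mem_Ioc (zero_lt_one (α := ℝ)) a y
    refine ⟨toIocMod (zero_lt_one (α := ℝ)) a y, h.1, h.2, ?_⟩
    have h2 := toIocMod_add_toIocDiv_zsmul (zero_lt_one (α := ℝ)) a y
    conv_rhs => rw [← h2]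
    simp only [zsmul_eq_mul, mul_one]
    exact (coe_add_intCast _ _).symm

lemma btw_imp {a b : ℝ} {y : AddCircle (1 : ℝ)} (hab : a < b) (hb : b ≤ a + 1)
    (h : btw (a : AddCircle (1 : ℝ)) y b) :
    ∃ z : ℝ, a ≤ z ∧ z ≤ b ∧ (z : AddCircle (1 : ℝ)) = y := by
  induction y using QuotientAddGroup.induction_on with
  | H y =>
    have h1 := QuotientAddGroup.btw_coe_iff.1 h
    have hm := toIcoMod_mem_Ico (zero_lt_one (α := ℝ)) a y
    have hbb : toIocMod (zero_lt_one (α := ℝ)) a b = b :=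
      (toIocMod_eq_self _).2 ⟨hab, hb⟩
    rw [hbb] at h1
    refine ⟨toIcoMod (zero_lt_one (α := ℝ)) a y, hm.1, h1, ?_⟩
    have h2 := toIcoMod_add_toIcoDiv_zsmul (zero_lt_one (α := ℝ)) a y
    conv_rhs => rw [← h2]
    simp only [zsmul_eq_mul, mul_one]
    exact (coe_add_intCast _ _).symm

/-- `(s, t)` lifts a complementary arc of `A`. -/
def IsGap (A : Set (AddCircle (1 : ℝ))) (s t : ℝ) : Prop :=
  s < t ∧ t < s + 1 ∧ (s : AddCircle (1 : ℝ)) ∈ A ∧ (t : AddCircle (1 : ℝ)) ∈ A ∧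
    ∀ z : ℝ, s < z → z < t → (z : AddCircle (1 : ℝ)) ∉ A

/-- The open arc. -/
def arc (s t : ℝ) : Set (AddCircle (1 : ℝ)) := (fun x : ℝ => (x : AddCircle (1 : ℝ))) '' Set.Ioo s t

lemma exists_gap {A : Set (AddCircle (1 : ℝ))} (hA : IsClosed A) (hA2 : A.Nontrivial)
    (x : ℝ) (hx : (x : AddCircle (1 : ℝ)) ∉ A) : ∃ s t, IsGap A s t ∧ s < x ∧ x < t := by
  set P : Set ℝ := (fun x : ℝ => (x : AddCircle (1 : ℝ))) ⁻¹' A with hP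
  have hPc : IsClosed P := hA.preimage (AddCircle.continuous_mk' 1)
  obtain ⟨a, ha, b, hb, hab⟩ := hA2
  have hS : sSup (P ∩ Set.Iic x) ∈ P ∩ Set.Iic x := by
    apply (hPc.inter isClosed_Iic).csSup_mem
    · obtain ⟨z, h1, h2, rfl⟩ := exists_lift_Ioc a (x - 1)
      exact ⟨z, ha, by simp; linarith⟩
    · exact ⟨x, fun z hz => hz.2⟩
  have hT : sInf (P ∩ Set.Ici x) ∈ P ∩ Set.Ici x := by
    apply (hPc.inter isClosed_Ici).csInf_mem
    · obtain ⟨z, h1, h2, rfl⟩ := exists_lift_Ioc a x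
      exact ⟨z, ha, h1.le⟩
    · exact ⟨x, fun z hz => hz.2⟩
  have hSm : ∀ z ∈ P, z ≤ x → z ≤ sSup (P ∩ Set.Iic x) := fun z hz hzx =>
    le_csSup ⟨x, fun z hz => hz.2⟩ ⟨hz, hzx⟩
  have hTm : ∀ z ∈ P, x ≤ z → sInf (P ∩ Set.Ici x) ≤ z := fun z hz hzx =>
    csInf_le ⟨x, fun z hz => hz.2⟩ ⟨hz, hzx⟩
  generalize sSup (P ∩ Set.Iic x) = s at *
  generalize sInf (P ∩ Set.Ici x) = t at *
  have hsx : s < x := lt_of_le_of_ne hS.2 (fun h => hx (h ▸ hS.1))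
  have hxt : x < t := lt_of_le_of_ne hT.2 (fun h => hx (h ▸ hT.1))
  refine ⟨s, t, ⟨hsx.trans hxt, ?_, hS.1, hT.1, ?_⟩, hsx, hxt⟩
  · -- some point other than `s` lies in the next period
    obtain ⟨c, hc, hcs⟩ : ∃ c ∈ A, c ≠ (s : AddCircle (1 : ℝ)) := by
      by_cases h : a = (s : AddCircle (1 : ℝ))
      · exact ⟨b, hb, fun h' => hab (h.trans h'.symm)⟩
      · exact ⟨a, ha, h⟩
    obtain ⟨z, h1, h2, rfl⟩ := exists_lift_Ioc c s
    have hz : z ≠ s + 1 := by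
      rintro rfl
      apply hcs
      simpa using coe_add_intCast s 1
    have hz' : z < s + 1 := lt_of_le_of_ne h2 hz
    by_contra hcon
    rcases le_total z x with h | h
    · linarith [hSm z hc h]
    · linarith [hTm z hc h]
  · intro z h1 h2 hz
    rcases le_total z x with h | h
    · linarith [hSm z hz h]
    · linarith [hTm z hz h]

lemma arc_isOpen (s t : ℝ) : IsOpen (arc s t) :=
  QuotientAddGroup.isOpenMap_coe _ isOpen_Ioo

lemma gap_component {A : Set (AddCircle (1 : ℝ))} {s t x : ℝ} (h : IsGap A s t)
    (h1 : s < x) (h2 : x < t) : connectedComponentIn Aᶜ (x : AddCircle (1 : ℝ)) = arc s t := by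
  obtain ⟨hst, hts, hs, ht, hd⟩ := h
  have hc : Continuous (fun x : ℝ => (x : AddCircle (1 : ℝ))) := AddCircle.continuous_mk' 1
  have hx : (x : AddCircle (1 : ℝ)) ∈ arc s t := ⟨x, ⟨h1, h2⟩, rfl⟩
  have hsub : arc s t ⊆ Aᶜ := by
    rintro _ ⟨z, hz, rfl⟩
    exact hd z hz.1 hz.2
  apply Set.Subset.antisymm
  · set K := connectedComponentIn Aᶜ (x : AddCircle (1 : ℝ)) with hK
    have hKp : IsPreconnected K := isPreconnected_connectedComponentIn
    have hKA : K ⊆ Aᶜ := connectedComponentIn_subset _ _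
    have hxK : (x : AddCircle (1 : ℝ)) ∈ K := mem_connectedComponentIn (hsub hx)
    set J := (fun x : ℝ => (x : AddCircle (1 : ℝ))) '' Set.Icc s t with hJ
    have hJc : IsClosed J := (isCompact_Icc.image hc).isClosed
    have hJA : ∀ y ∈ K, y ∈ J → y ∈ arc s t := by
      rintro y hy ⟨z, hz, rfl⟩
      refine ⟨z, ⟨lt_of_le_of_ne hz.1 ?_, lt_of_le_of_ne hz.2 ?_⟩, rfl⟩
      · rintro rfl; exact hKA hy hs
      · rintro rfl; exact hKA hy ht
    intro y hy
    by_contra hyn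
    have hcov : K ⊆ arc s t ∪ Jᶜ := by
      intro w hw
      by_cases hwJ : w ∈ J
      · exact Or.inl (hJA w hw hwJ)
      · exact Or.inr hwJ
    obtain ⟨w, hw, hw1, hw2⟩ := hKp _ _ (arc_isOpen s t) hJc.isOpen_compl hcov ⟨_, hxK, hx⟩
      ⟨y, hy, fun hyJ => hyn (hJA y hy hyJ)⟩
    apply hw2
    obtain ⟨z, hz, rfl⟩ := hw1
    exact ⟨z, ⟨hz.1.le, hz.2.le⟩, rfl⟩
  · exact (isPreconnected_Ioo.image _ hc.continuousOn).subset_connectedComponentIn hx hsub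

lemma gap_isComplArc {A : Set (AddCircle (1 : ℝ))} {s t : ℝ} (h : IsGap A s t) :
    IsComplArc A (arc s t) := by
  have h0 := h.1
  refine ⟨(((s + t) / 2 : ℝ) : AddCircle (1 : ℝ)), h.2.2.2.2 _ (by linarith) (by linarith), ?_⟩
  exact (gap_component h (by linarith) (by linarith)).symm

lemma isComplArc_gap {A C : Set (AddCircle (1 : ℝ))} (hA : IsClosed A) (hA2 : A.Nontrivial)
    (h : IsComplArc A C) : ∃ s t, IsGap A s t ∧ C = arc s t := by
  obtain ⟨x, hx, rfl⟩ := h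
  obtain ⟨x, -, -, rfl⟩ := exists_lift_Ioc x 0
  obtain ⟨s, t, hg, h1, h2⟩ := exists_gap hA hA2 x hx
  exact ⟨s, t, hg, gap_component hg h1 h2⟩

lemma volume_arc {s t : ℝ} (ht : t ≤ s + 1) : volume (arc s t) = ENNReal.ofReal (t - s) := by
  rw [AddCircle.add_projection_respects_measure 1 s (arc_isOpen s t).measurableSet]
  have : (QuotientAddGroup.mk ⁻¹' arc s t ∩ Set.Ioc s (s + 1) : Set ℝ) = Set.Ioo s t := by
    ext z
    constructor
    · rintro ⟨⟨w, hw, hwz⟩, hz⟩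
      obtain ⟨n, hn⟩ := coe_eq_int hwz
      have h1 : (n : ℝ) < 1 := by linarith [hw.1, hz.2]
      have h2 : (-1 : ℝ) < n := by linarith [hw.2, hz.1]
      have h3 : n < 1 := by exact_mod_cast h1
      have h4 : -1 < n := by exact_mod_cast h2
      obtain rfl : n = 0 := by omega
      simp at hn
      exact hn ▸ hw
    · intro hz
      exact ⟨⟨z, hz, rfl⟩, hz.1, by linarith [hz.2]⟩
  rw [this, Real.volume_Ioo]

lemma half_lt_volume_arc {s t : ℝ} (ht : t ≤ s + 1) : 1 / 2 < volume (arc s t) ↔ 1 / 2 < t - s := by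
  rw [volume_arc ht]
  have : (1 / 2 : ENNReal) = ENNReal.ofReal (1 / 2) := by
    rw [ENNReal.ofReal_div_of_pos (by norm_num)]; simp
  rw [this, ENNReal.ofReal_lt_ofReal_iff']
  constructor
  · exact fun h => h.1
  · exact fun h => ⟨h, by linarith⟩

/-- The image of a gap: any lift of the endpoints' images gives a gap. -/
lemma gap_image {A B : Set (AddCircle (1 : ℝ))} (hb : Set.BijOn dbl A B)
    (hcyc : ∀ x ∈ A, ∀ y ∈ A, ∀ z ∈ A, sbtw x y z → sbtw (dbl x) (dbl y) (dbl z))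
    {s t s' t' : ℝ} (h : IsGap A s t) (hs' : dbl (s : AddCircle (1 : ℝ)) = s')
    (ht' : dbl (t : AddCircle (1 : ℝ)) = t') (h1 : s' < t') (h2 : t' < s' + 1) :
    IsGap B s' t' := by
  obtain ⟨hst, hts, hs, ht, hd⟩ := h
  refine ⟨h1, h2, hs' ▸ hb.mapsTo hs, ht' ▸ hb.mapsTo ht, ?_⟩
  intro z hz1 hz2 hz
  obtain ⟨x, hx, hxz⟩ := hb.surjOn hz
  have key : ∀ w : ℝ, t' ≤ w → w ≤ s' + 1 → (w : AddCircle (1 : ℝ)) ≠ z := by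
    intro w hw1 hw2 hwz
    obtain ⟨n, hn⟩ := coe_eq_int hwz
    have h1 : (n : ℝ) < 0 := by linarith
    have h2 : (-1 : ℝ) < n := by linarith
    have h3 : n < 0 := by exact_mod_cast h1
    have h4 : -1 < n := by exact_mod_cast h2
    omega
  have hxs : x ≠ (s : AddCircle (1 : ℝ)) := by
    rintro rfl
    refine key (s' + 1) (by linarith) le_rfl ?_
    rw [← hxz, hs']
    simpa using coe_add_intCast s' 1
  have hxt : x ≠ (t : AddCircle (1 : ℝ)) := by
    rintro rfl
    refine key t' le_rfl (by linarith) ?_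
    rw [← hxz, ht']
  have hb1 : sbtw (t : AddCircle (1 : ℝ)) x s := by
    rw [sbtw_iff_not_btw]
    intro hbt
    obtain ⟨w, hw1, hw2, rfl⟩ := btw_imp hst hts.le hbt
    refine hd w (lt_of_le_of_ne hw1 ?_) (lt_of_le_of_ne hw2 ?_) hx
    · rintro rfl; exact hxs rfl
    · rintro rfl; exact hxt rfl
  have hb2 := hcyc _ ht _ hx _ hs hb1
  rw [hs', ht', hxz] at hb2
  have hb3 := btw_of_sbtw hb2
  have hsc : (s' : AddCircle (1 : ℝ)) = ((s' + 1 : ℝ) : AddCircle (1 : ℝ)) := by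
    simpa using (coe_add_intCast s' 1).symm
  rw [hsc] at hb3
  obtain ⟨w, hw1, hw2, hw⟩ := btw_imp h2 (by linarith) hb3
  exact key w hw1 hw2 hw

lemma gap_ne_half {A B : Set (AddCircle (1 : ℝ))} (hb : Set.BijOn dbl A B)
    {s t : ℝ} (h : IsGap A s t) : t - s ≠ 1 / 2 := by
  intro hh
  obtain ⟨hst, hts, hs, ht, hd⟩ := h
  have : (s : AddCircle (1 : ℝ)) = t := by
    apply hb.injOn hs ht
    rw [dbl_coe, dbl_coe, ← coe_add_intCast (2 * s) 1]
    congr 1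
    push_cast
    linarith
  obtain ⟨n, hn⟩ := coe_eq_int this
  have h1 : (n : ℝ) < 1 := by linarith
  have h2 : (0 : ℝ) < n := by linarith
  have h3 : n < 1 := by exact_mod_cast h1
  have h4 : 0 < n := by exact_mod_cast h2
  omega

lemma dbl_image_arc (s t : ℝ) : dbl '' arc s t = arc (2 * s) (2 * t) := by
  ext y
  constructor
  · rintro ⟨_, ⟨z, hz, rfl⟩, rfl⟩
    exact ⟨2 * z, ⟨by linarith [hz.1], by linarith [hz.2]⟩, (dbl_coe z).symm⟩
  · rintro ⟨z, hz, rfl⟩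
    refine ⟨_, ⟨z / 2, ⟨by linarith [hz.1], by linarith [hz.2]⟩, rfl⟩, ?_⟩
    rw [dbl_coe]
    congr 1
    ring

/-- For a formal orbit portrait of valence `v ≥ 2` and each index `i`:
(a) `A_i` has exactly one complementary arc of length `> 1/2` (the critical arc);
(b) every other complementary arc of `A_i` is mapped injectively by doubling onto a
complementary arc of `A_{i+1}`;
(c) the critical arc is mapped onto the whole circle; more precisely there is a complementary
arc `C'` of `A_{i+1}` each of whose points has exactly two doubling-preimages in the critical
arc, while every point outside the closure of `C'` has exactly one doubling-preimage in the
critical arc. -/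
theorem formalOrbitPortrait_critical_arc (p r v : ℕ) (O : FormalOrbitPortrait p r)
    (hv : ∀ j, (O.A j).ncard = v) (hv2 : 2 ≤ v) (i : ZMod p) :
    (∃! C : Set (AddCircle (1 : ℝ)), IsComplArc (O.A i) C ∧ 1 / 2 < volume C) ∧
    (∀ C : Set (AddCircle (1 : ℝ)), IsComplArc (O.A i) C → ¬ (1 / 2 < volume C) →
      Set.InjOn dbl C ∧ ∃ C', IsComplArc (O.A (i + 1)) C' ∧ dbl '' C = C') ∧
    (∀ C : Set (AddCircle (1 : ℝ)), IsComplArc (O.A i) C → 1 / 2 < volume C →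
      dbl '' C = Set.univ ∧
      ∃ C', IsComplArc (O.A (i + 1)) C' ∧
        (∀ y ∈ C', Set.ncard {x ∈ C | dbl x = y} = 2) ∧
        (∀ y ∉ closure C', Set.ncard {x ∈ C | dbl x = y} = 1)) := by
  have hb := O.bijOn i
  have hcyc := O.cyclicOrder i
  have hcl : IsClosed (O.A i) := (O.finite i).isClosed
  have hnt : (O.A i).Nontrivial := by
    rw [← Set.one_lt_ncard_iff_nontrivial_and_finite.trans (and_iff_left (O.finite i)), hv]
    omega
  refine ⟨?_, ?_, ?_⟩
  · -- existence and uniqueness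
    obtain ⟨a, ha⟩ := O.nonempty i
    obtain ⟨a, -, -, rfl⟩ := exists_lift_Ioc a 0
    have hna : ((a + 1 / 2 : ℝ) : AddCircle (1 : ℝ)) ∉ O.A i := by
      intro h
      have h2 : (a : AddCircle (1 : ℝ)) = ((a + 1 / 2 : ℝ) : AddCircle (1 : ℝ)) := by
        apply hb.injOn ha h
        rw [dbl_coe, dbl_coe, ← coe_add_intCast (2 * a) 1]
        congr 1
        push_cast
        ring
      obtain ⟨n, hn⟩ := coe_eq_int h2
      have h1 : (n : ℝ) < 1 := by linarith
      have h2 : (0 : ℝ) < n := by linarith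
      have h3 : n < 1 := by exact_mod_cast h1
      have h4 : 0 < n := by exact_mod_cast h2
      omega
    obtain ⟨s, t, hg, h1, h2⟩ := exists_gap hcl hnt _ hna
    have hlen : 1 / 2 < t - s := by
      by_contra hcon
      have hlt : t - s < 1 / 2 := lt_of_le_of_ne (not_lt.1 hcon) (gap_ne_half hb hg)
      have hg' := gap_image hb hcyc hg (dbl_coe s) (dbl_coe t) (by linarith [hg.1]) (by linarith)
      refine hg'.2.2.2.2 (2 * (a + 1 / 2)) (by linarith) (by linarith) ?_
      have := hb.mapsTo ha
      rw [dbl_coe, ← coe_add_intCast (2 * a) 1] at this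
      convert this using 2
      push_cast
      ring
    refine ⟨arc s t, ⟨gap_isComplArc hg, (half_lt_volume_arc hg.2.1.le).2 hlen⟩, ?_⟩
    rintro C ⟨hC, hCv⟩
    obtain ⟨s', t', hg', rfl⟩ := isComplArc_gap hcl hnt hC
    have hlen' := (half_lt_volume_arc hg'.2.1.le).1 hCv
    by_contra hne
    have hdisj : Disjoint (arc s' t') (arc s t) := by
      rw [Set.disjoint_left]
      rintro y ⟨z, hz, rfl⟩ ⟨w, hw, hwz⟩
      apply hne
      rw [← gap_component hg' hz.1 hz.2, ← gap_component hg hw.1 hw.2]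
      exact congrArg _ hwz.symm
    have hle : volume (arc s' t' ∪ arc s t) ≤ 1 := by
      calc _ ≤ volume (Set.univ : Set (AddCircle (1 : ℝ))) := measure_mono (Set.subset_univ _)
        _ = 1 := by rw [AddCircle.measure_univ]; simp
    rw [measure_union hdisj (arc_isOpen s t).measurableSet, volume_arc hg.2.1.le,
      volume_arc hg'.2.1.le, ← ENNReal.ofReal_add (by linarith) (by linarith),
      ENNReal.ofReal_le_one] at hle
    linarith
  · intro C hC hCv
    obtain ⟨s, t, hg, rfl⟩ := isComplArc_gap hcl hnt hC
    rw [half_lt_volume_arc hg.2.1.le] at hCv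
    have hlt : t - s < 1 / 2 := lt_of_le_of_ne (not_lt.1 hCv) (gap_ne_half hb hg)
    constructor
    · rintro _ ⟨z, hz, rfl⟩ _ ⟨w, hw, rfl⟩ h
      simp only [dbl_coe] at h
      obtain ⟨n, hn⟩ := coe_eq_int h
      have h1 : (n : ℝ) < 1 := by linarith [hz.1, hz.2, hw.1, hw.2]
      have h2 : (-1 : ℝ) < n := by linarith [hz.1, hz.2, hw.1, hw.2]
      have h3 : n < 1 := by exact_mod_cast h1
      have h4 : -1 < n := by exact_mod_cast h2
      obtain rfl : n = 0 := by omega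
      simp at hn
      rw [hn]
    · have hg' := gap_image hb hcyc hg (dbl_coe s) (dbl_coe t) (by linarith [hg.1]) (by linarith)
      exact ⟨_, gap_isComplArc hg', dbl_image_arc s t⟩
  · intro C hC hCv
    obtain ⟨s, t, hg, rfl⟩ := isComplArc_gap hcl hnt hC
    rw [half_lt_volume_arc hg.2.1.le] at hCv
    have hts := hg.2.1
    constructor
    · rw [dbl_image_arc, Set.eq_univ_iff_forall]
      intro y
      obtain ⟨z, hz1, hz2, rfl⟩ := exists_lift_Ioc y (2 * s)
      exact ⟨z, ⟨hz1, by linarith⟩, rfl⟩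
    have hs1 : dbl (s : AddCircle (1 : ℝ)) = ((2 * s + 1 : ℝ) : AddCircle (1 : ℝ)) := by
      rw [dbl_coe]
      simpa using (coe_add_intCast (2 * s) 1).symm
    have hg' := gap_image hb hcyc hg hs1 (dbl_coe t) (by linarith) (by linarith)
    have hsub : ∀ y : ℝ, ((2 * ((y - 1) / 2) : ℝ) : AddCircle (1 : ℝ)) = y := by
      intro y
      rw [← coe_add_intCast _ 1]
      congr 1
      push_cast
      ring
    refine ⟨_, gap_isComplArc hg', ?_, ?_⟩
    · rintro _ ⟨y, hy, rfl⟩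
      rw [Set.ncard_eq_two]
      refine ⟨((y / 2 : ℝ) : AddCircle (1 : ℝ)), (((y - 1) / 2 : ℝ) : AddCircle (1 : ℝ)), ?_, ?_⟩
      · intro h
        obtain ⟨n, hn⟩ := coe_eq_int h
        have h1 : (n : ℝ) < 0 := by linarith
        have h2 : (-1 : ℝ) < n := by linarith
        have h3 : n < 0 := by exact_mod_cast h1
        have h4 : -1 < n := by exact_mod_cast h2
        omega
      · ext x
        constructor
        · rintro ⟨⟨z, hz, rfl⟩, hzy⟩
          simp only [dbl_coe] at hzy
          obtain ⟨n, hn⟩ := coe_eq_int hzy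
          have h1 : (n : ℝ) < 2 := by linarith [hz.1, hz.2, hy.1, hy.2]
          have h2 : (-1 : ℝ) < n := by linarith [hz.1, hz.2, hy.1, hy.2]
          have h3 : n < 2 := by exact_mod_cast h1
          have h4 : -1 < n := by exact_mod_cast h2
          obtain rfl | rfl : n = 0 ∨ n = 1 := by omega
          · left
            change (z : AddCircle (1 : ℝ)) = _
            congr 1
            push_cast at hn
            linarith
          · right
            change (z : AddCircle (1 : ℝ)) = _
            congr 1
            push_cast at hn
            linarith
        · rintro (rfl | rfl)
          · refine ⟨⟨_, ⟨?_, ?_⟩, rfl⟩, ?_⟩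
            · linarith [hy.1]
            · linarith [hy.2]
            · rw [dbl_coe]
              change _ = (y : AddCircle (1 : ℝ))
              congr 1
              ring
          · refine ⟨⟨_, ⟨?_, ?_⟩, rfl⟩, ?_⟩
            · linarith [hy.1]
            · linarith [hy.2]
            · rw [dbl_coe]
              exact hsub y
    · intro y hy
      obtain ⟨y, hy1, hy2, rfl⟩ := exists_lift_Ioc y (2 * s + 1)
      have hIcc : ∀ z : ℝ, 2 * s + 1 ≤ z → z ≤ 2 * t → (z : AddCircle (1 : ℝ)) ≠ y := by
        intro z hz1 hz2 hzy
        apply hy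
        rw [← hzy]
        refine image_closure_subset_closure_image (AddCircle.continuous_mk' 1) ⟨z, ?_, rfl⟩
        rw [closure_Ioo (by linarith)]
        exact ⟨hz1, hz2⟩
      have hyt : 2 * t < y := by
        by_contra h
        exact hIcc y hy1.le (not_lt.1 h) rfl
      have hys : y < 2 * s + 2 := by
        refine lt_of_le_of_ne (by linarith) ?_
        rintro rfl
        refine hIcc (2 * s + 1) le_rfl (by linarith) ?_
        rw [← coe_add_intCast (2 * s + 1) 1]
        congr 1
        push_cast
        ring
      rw [Set.ncard_eq_one]
      refine ⟨(((y - 1) / 2 : ℝ) : AddCircle (1 : ℝ)), ?_⟩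
      ext x
      constructor
      · rintro ⟨⟨z, hz, rfl⟩, hzy⟩
        simp only [dbl_coe] at hzy
        obtain ⟨n, hn⟩ := coe_eq_int hzy
        have h1 : (n : ℝ) < 2 := by linarith [hz.1, hz.2]
        have h2 : (0 : ℝ) < n := by linarith [hz.1, hz.2]
        have h3 : n < 2 := by exact_mod_cast h1
        have h4 : 0 < n := by exact_mod_cast h2
        obtain rfl : n = 1 := by omega
        change (z : AddCircle (1 : ℝ)) = _
        congr 1
        push_cast at hn
        linarith
      · rintro rfl
        refine ⟨⟨_, ⟨?_, ?_⟩, rfl⟩, ?_⟩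
        · linarith
        · linarith
        · rw [dbl_coe]
          exact hsub y
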